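/- Let T be a tree with n vertices which is not a path. Then there exists a bijective labeling of the vertices of T by {1,…,n} such that every admissible path has at most 3 vertices if and only if there exists a bijective labeling of the vertices of T by {1,…,n} such that d(i, i+1) ≤ 2 for every 1 ≤ i < n, where d denotes graph distance. -/

import Mathlib

/-- A list of vertices forms a path in `G`: consecutive vertices are adjacent
and all vertices are distinct. -/
def IsPathList {V : Type*} (G : SimpleGraph V) (l : List V) : Prop :=
  l.Chain' G.Adj ∧ l.Nodup

/-- A list of vertices is an *admissible path* in a graph `G` on `{1,…,n}`
(modeled as `Fin n`): it is a path from `i` to `j` with `i < j`, every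
interior vertex is `< i` or `> j`, and no proper (ordered) subset of the
interior vertices together with `i` and `j` forms a path in `G`. -/
def IsAdmissible {n : ℕ} (G : SimpleGraph (Fin n)) (l : List (Fin n)) : Prop :=
  ∃ i j : Fin n, i < j ∧ l.head? = some i ∧ l.getLast? = some j ∧
    IsPathList G l ∧
    (∀ v ∈ l.tail.dropLast, v < i ∨ j < v) ∧
    (∀ l' : List (Fin n), l'.Sublist l.tail.dropLast → l' ≠ l.tail.dropLast →
      ¬ IsPathList G (i :: (l' ++ [j])))

/-- A chain from `i` to `j` bounds the distance between `i` and `j`. -/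
theorem SimpleGraph.dist_le_of_isChain {V : Type*} {G : SimpleGraph V} {i j : V} {m : List V}
    (h : List.IsChain G.Adj (i :: (m ++ [j]))) : G.dist i j ≤ m.length + 1 := by
  have hw := SimpleGraph.dist_le (SimpleGraph.Walk.ofSupport _ (List.cons_ne_nil _ _) h)
  rw [SimpleGraph.Walk.length_ofSupport] at hw
  simpa using hw

/-- A chain avoiding `a` stays connected after deleting an edge at `a`. -/
theorem SimpleGraph.reachable_deleteEdges_of_isChain {V : Type*} {G : SimpleGraph V} {a c : V}
    {b : V} {l : List V} (h : List.IsChain G.Adj (b :: l)) (ha : a ∉ b :: l) {x : V}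
    (hx : x ∈ b :: l) : (G.deleteEdges {s(a, c)}).Reachable b x := by
  induction l generalizing b with
  | nil =>
    obtain rfl : x = b := by simpa using hx
    rfl
  | cons d l ih =>
    rcases List.mem_cons.1 hx with rfl | hx
    · rfl
    · rw [List.isChain_cons_cons] at h
      have hbd : (G.deleteEdges {s(a, c)}).Adj b d := by
        rw [SimpleGraph.deleteEdges_adj]
        refine ⟨h.1, ?_⟩
        simp only [List.mem_cons, not_or] at ha
        rw [Set.mem_singleton_iff, Sym2.eq_iff]
        tauto
      exact hbd.reachable.trans (ih h.2 (fun h' => ha (List.mem_cons_of_mem _ h')) hx)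

/-- Vertices at distance at most two, both different from `a` and `b`, stay connected after
deleting the edge `ab`. -/
theorem SimpleGraph.Connected.reachable_deleteEdges_of_dist_le_two {V : Type*} {G : SimpleGraph V}
    (hG : G.Connected) {a b u v : V} (hd : G.dist u v ≤ 2) (hua : u ≠ a) (hub : u ≠ b)
    (hva : v ≠ a) (hvb : v ≠ b) : (G.deleteEdges {s(a, b)}).Reachable u v := by
  obtain ⟨p, hp⟩ := hG.exists_walk_length_eq_dist u v
  have key : ∀ {x y : V}, x ≠ a → x ≠ b → G.Adj x y → (G.deleteEdges {s(a, b)}).Reachable x y := by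
    intro x y hxa hxb hxy
    refine SimpleGraph.Adj.reachable ?_
    rw [SimpleGraph.deleteEdges_adj, Set.mem_singleton_iff, Sym2.eq_iff]
    exact ⟨hxy, by tauto⟩
  match p, hp with
  | .nil, _ => rfl
  | .cons h .nil, _ => exact key hua hub h
  | .cons h (.cons h' .nil), _ => exact (key hua hub h).trans (key hva hvb h'.symm).symm
  | .cons h (.cons h' (.cons h'' q)), hp =>
    simp only [SimpleGraph.Walk.length_cons] at hp
    omega

/-- If all admissible paths have at most three vertices, consecutive labels are at distance at
most two. -/
theorem dist_le_two_of_isAdmissible_length_le {n : ℕ} {G : SimpleGraph (Fin n)}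
    (hG : G.Connected) (h : ∀ l : List (Fin n), IsAdmissible G l → l.length ≤ 3)
    {i j : Fin n} (hij : (j : ℕ) = (i : ℕ) + 1) : G.dist i j ≤ 2 := by
  obtain ⟨p, hp, hpd⟩ := hG.exists_path_of_dist i j
  have hlt : i < j := by rw [Fin.lt_def]; omega
  obtain ⟨m, hm⟩ : ∃ m, p.support = i :: (m ++ [j]) := by
    cases p with
    | nil => exact absurd hlt (lt_irrefl _)
    | cons h' q =>
      refine ⟨q.support.dropLast, ?_⟩
      rw [SimpleGraph.Walk.support_cons]
      congr 1
      conv_lhs => rw [← List.dropLast_append_getLast q.support_ne_nil]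
      rw [SimpleGraph.Walk.getLast_support]
  have hlen : p.length = m.length + 1 := by
    have := p.length_support
    rw [hm] at this
    simpa using this.symm
  have hchain : List.IsChain G.Adj (i :: (m ++ [j])) := hm ▸ p.isChain_adj_support
  have hnodup : (i :: (m ++ [j])).Nodup := hm ▸ hp.support_nodup
  have hint : (i :: (m ++ [j])).tail.dropLast = m := by simp
  have hadm : IsAdmissible G (i :: (m ++ [j])) := by
    refine ⟨i, j, hlt, rfl, (List.getLast?_concat (l := i :: m)), ⟨hchain, hnodup⟩, ?_, ?_⟩
    · rw [hint]
      intro v hv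
      have hvi : v ≠ i := by rintro rfl; simp [hv] at hnodup
      have hvj : v ≠ j := by
        rintro rfl
        simp only [List.nodup_cons, List.nodup_append] at hnodup
        exact hnodup.2.2.2 v hv v (by simp) rfl
      rw [Ne, Fin.ext_iff] at hvi hvj
      rw [Fin.lt_def, Fin.lt_def]
      omega
    · rw [hint]
      intro l' hl' hne hpath
      have h1 := SimpleGraph.dist_le_of_isChain hpath.1
      have h2 := hl'.length_le
      exact hne (hl'.eq_of_length_le (by omega))
  have := h _ hadm
  simp only [List.length_cons, List.length_append, List.length_nil] at this
  omega

/-- In a tree where consecutive labels are at distance at most two, all admissible paths have at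
most three vertices. -/
theorem IsAdmissible.length_le_three {n : ℕ} {G : SimpleGraph (Fin n)} (hG : G.IsTree)
    (h : ∀ i j : Fin n, (j : ℕ) = (i : ℕ) + 1 → G.dist i j ≤ 2) {l : List (Fin n)}
    (hl : IsAdmissible G l) : l.length ≤ 3 := by
  obtain ⟨i, j, hij, hhead, hlast, ⟨hchain, hnodup⟩, hint, -⟩ := hl
  by_contra! hlen
  match l, hlen with
  | i' :: a :: b :: c :: r, _ =>
    obtain rfl : i' = i := by simpa using hhead
    have hchain : List.IsChain G.Adj (i' :: a :: b :: c :: r) := hchain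
    simp only [List.tail_cons, List.dropLast_cons_cons, List.mem_cons] at hint
    have hai := hint a (by simp)
    have hbi := hint b (by simp)
    have hjmem : j ∈ b :: c :: r := by
      have h' : (b :: c :: r).getLast? = some j := by simpa [List.getLast?_cons_cons] using hlast
      exact List.mem_of_getLast? h'
    rw [List.isChain_cons_cons, List.isChain_cons_cons] at hchain
    obtain ⟨hia, hab, hrest⟩ := hchain
    have hanot : a ∉ b :: c :: r := (List.nodup_cons.1 (List.nodup_cons.1 hnodup).2).1
    have hne : ∀ k : Fin n, i' ≤ k → k ≤ j → k ≠ a ∧ k ≠ b := by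
      intro k h1 h2
      constructor <;> rintro rfl
      · exact hai.elim (fun h => absurd h1 (not_le.2 h)) (fun h => absurd h2 (not_le.2 h))
      · exact hbi.elim (fun h => absurd h1 (not_le.2 h)) (fun h => absurd h2 (not_le.2 h))
    have hbridge := SimpleGraph.isAcyclic_iff_forall_adj_isBridge.1 hG.isAcyclic hab
    rw [SimpleGraph.isBridge_iff] at hbridge
    have hwalk : ∀ k (hk : k < n), (i' : ℕ) ≤ k → k ≤ (j : ℕ) →
        (G.deleteEdges {s(a, b)}).Reachable i' ⟨k, hk⟩ := by
      intro k hk hik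
      induction k, hik using Nat.le_induction with
      | base => intro _; rfl
      | succ k hik ih =>
        intro hkj
        have h1 := hne ⟨k, by omega⟩ hik (Fin.le_def.2 (by simp; omega))
        have h2 := hne ⟨k + 1, hk⟩ (Fin.le_def.2 (by simp; omega)) hkj
        exact (ih (by omega) (by omega)).trans
          (hG.connected.reachable_deleteEdges_of_dist_le_two (h _ _ rfl) h1.1 h1.2 h2.1 h2.2)
    have hi := hne i' le_rfl hij.le
    have hai' : (G.deleteEdges {s(a, b)}).Reachable a i' := by
      refine (SimpleGraph.Adj.reachable ?_).symm
      rw [SimpleGraph.deleteEdges_adj, Set.mem_singleton_iff, Sym2.eq_iff]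
      exact ⟨hia, by tauto⟩
    exact hbridge ((hai'.trans (hwalk j j.2 hij.le le_rfl)).trans
      (SimpleGraph.reachable_deleteEdges_of_isChain hrest hanot hjmem).symm)

/-- A tree `T` with `n` vertices which is not a path admits a labeling by
`{1,…,n}` in which every admissible path has at most 3 vertices if and only
if it admits a labeling in which `d(i, i+1) ≤ 2` for all `1 ≤ i < n`. -/
theorem tree_three_closed_iff_dist_labeling {V : Type*} [Fintype V] {n : ℕ}
    (T : SimpleGraph V) (hT : T.IsTree) (hcard : Fintype.card V = n)
    (hnotpath : ¬ ∀ v : V, (T.neighborSet v).ncard ≤ 2) :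
    (∃ e : V ≃ Fin n, ∀ l : List (Fin n),
        IsAdmissible (T.map e.toEmbedding) l → l.length ≤ 3) ↔
    (∃ e : V ≃ Fin n, ∀ i j : Fin n, (j : ℕ) = (i : ℕ) + 1 →
        (T.map e.toEmbedding).dist i j ≤ 2) := by
  have htree : ∀ e : V ≃ Fin n, (T.map e.toEmbedding).IsTree := fun e =>
    (SimpleGraph.Iso.map e T).isTree_iff.1 hT
  exact exists_congr fun e =>
    ⟨fun h _ _ hij => dist_le_two_of_isAdmissible_length_le (htree e).connected h hij,
      fun h _ hl => hl.length_le_three (htree e) h⟩
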